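/- arXiv:1302.0336 — 2 statements merged into one kernel-verified Lean document; each statement's English description precedes it below -/
import Mathlib

section
/- Let f, f_1, …, f_m : (0,∞) → ℝ be convex functions with f(1) = f_i(1) = 0, and suppose the divergences D_{f_1}, …, D_{f_m} are all finite, i.e. sup_{P,Q} D_{f_i}(P‖Q) < ∞ for each i. Then for every D_1, …, D_m ≥ 0, B(D_1,…,D_m) = B_{m+2}(D_1,…,D_m); that is, the infimum of D_f(P‖Q) over all pairs of probability measures P, Q on all possible measurable spaces subject to D_{f_i}(P‖Q) ≥ D_i for all i equals the infimum of D_f(P‖Q) over pairs of probability measures on the finite set {1,…,m+2} subject to the same constraints. -/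
open MeasureTheory Filter Set
open scoped ENNReal NNReal Classical

noncomputable section

/-- The limit of `f` at `0` from the right, as an extended real number
(for `f` convex on `(0,∞)` the `limsup` below is the actual limit). -/
def limAtZero (f : ℝ → ℝ) : EReal :=
  Filter.limsup (fun x => (f x : EReal)) (nhdsWithin 0 (Set.Ioi 0))

/-- The limit of `f x / x` as `x → ∞`, as an extended real number
(for `f` convex on `(0,∞)` the `limsup` below is the actual limit). -/
def derivAtTop (f : ℝ → ℝ) : EReal :=
  Filter.limsup (fun x => ((f x / x : ℝ) : EReal)) Filter.atTop

/-- The `f`-divergence `D_f(P‖Q) = ∫_{q>0} f(p/q) dQ + f'(∞) P{q = 0}`, where the part of the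
integral over `{p = 0, q > 0}` is interpreted via the limit `f(0) := lim_{x↓0} f x`, and the part
over `{q = 0}` (the `Q`-singular part of `P`) via `f'(∞) := lim_{x→∞} f x / x`. -/
def fDiv (f : ℝ → ℝ) {Ω : Type*} [MeasurableSpace Ω] (P Q : Measure Ω) : EReal :=
  (if Integrable (fun x => f ((Measure.rnDeriv P Q x).toReal))
      (Q.restrict {x | Measure.rnDeriv P Q x ≠ 0})
   then ((∫ x in {x | Measure.rnDeriv P Q x ≠ 0},
       f ((Measure.rnDeriv P Q x).toReal) ∂Q : ℝ) : EReal)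
   else (⊤ : EReal))
  + limAtZero f * ((Q {x | Measure.rnDeriv P Q x = 0} : ℝ≥0∞) : EReal)
  + derivAtTop f * ((Measure.singularPart P Q Set.univ : ℝ≥0∞) : EReal)

/-- A pair of probability measures on an arbitrary measurable space. -/
structure PMPair where
  carrier : Type
  inst : MeasurableSpace carrier
  P : @Measure carrier inst
  Q : @Measure carrier inst
  probP : @IsProbabilityMeasure carrier inst P
  probQ : @IsProbabilityMeasure carrier inst Q

attribute [instance] PMPair.inst

/-- The total variation distance `V(P,Q) = (1/2) ∫ |p - q| dλ` (with `λ = P + Q`). -/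
def tvDist {Ω : Type*} [MeasurableSpace Ω] (P Q : Measure Ω) : ℝ :=
  (∫ x, |(Measure.rnDeriv P (P + Q) x).toReal - (Measure.rnDeriv Q (P + Q) x).toReal|
    ∂(P + Q)) / 2

/-- The function `ψ_{P,Q}(s) = ∫ min (p, q s) dλ` (with `λ = P + Q`). -/
def psiPQ {Ω : Type*} [MeasurableSpace Ω] (P Q : Measure Ω) (s : ℝ) : ℝ :=
  ∫ x, min ((Measure.rnDeriv P (P + Q) x).toReal)
    ((Measure.rnDeriv Q (P + Q) x).toReal * s) ∂(P + Q)

/-- The right derivative of `f`. -/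
def rightDeriv (f : ℝ → ℝ) (x : ℝ) : ℝ := derivWithin f (Set.Ioi x) x

/-- `ν` is the measure `ν_f` on `(0,∞)` with `ν (a,b] = ∂⁺f(b) - ∂⁺f(a)`. -/
def IsCurvatureMeasure (f : ℝ → ℝ) (ν : Measure ℝ) : Prop :=
  ∀ a b : ℝ, 0 < a → a ≤ b →
    ν (Set.Ioc a b) = ENNReal.ofReal (rightDeriv f b - rightDeriv f a)

/-- The functional `I_f(ψ) = ∫_{(0,∞)} (min(1,s) - ψ(s)) dν_f(s)`. -/
def Ifun (ν : Measure ℝ) (ψ : ℝ → ℝ) : ℝ≥0∞ :=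
  ∫⁻ s in Set.Ioi (0 : ℝ), ENNReal.ofReal (min 1 s - ψ s) ∂ν

/-- The class `C` of functions on `[0,∞)` (encoded as functions on `ℝ` vanishing on `(-∞,0)`)
that are nonnegative, concave, nondecreasing and bounded by `min(1,s)` on `[0,∞)`. -/
def Cclass : Set (ℝ → ℝ) :=
  {ψ | (∀ s, 0 ≤ s → 0 ≤ ψ s) ∧ ConcaveOn ℝ (Set.Ici 0) ψ ∧ MonotoneOn ψ (Set.Ici 0) ∧
    (∀ s, 0 ≤ s → ψ s ≤ min 1 s) ∧ ∀ s, s < 0 → ψ s = 0}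

/-- The mean of an integrable random vector in finite dimension lies in any convex set
containing it almost surely. -/
theorem aux_weak_sep {E : Type} [NormedAddCommGroup E] [NormedSpace ℝ E]
    [FiniteDimensional ℝ E] {C : Set E} (hC : Convex ℝ C) (hne : C.Nonempty) {x : E} (hx : x ∉ C)
    (hxc : x ∈ closure C) : ∃ L : StrongDual ℝ E, L ≠ 0 ∧ ∀ c ∈ C, L c ≤ L x := by
  by_cases hi : (interior C).Nonempty
  · obtain ⟨L, hL⟩ := geometric_hahn_banach_open_point hC.interior isOpen_interior
      (fun h => hx (interior_subset h))
    refine ⟨L, ?_, ?_⟩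
    · rintro rfl
      obtain ⟨a, ha⟩ := hi
      simpa using hL a ha
    · intro c hc
      have h1 : c ∈ closure (interior C) := by
        rw [hC.closure_interior_eq_closure_of_nonempty_interior hi]; exact subset_closure hc
      have h2 : closure (interior C) ⊆ {y | L y ≤ L x} :=
        closure_minimal (fun a ha => (hL a ha).le) (isClosed_le L.continuous continuous_const)
      exact h2 h1
  · rw [hC.interior_nonempty_iff_affineSpan_eq_top] at hi
    obtain ⟨c0, hc0⟩ := hne
    have hdir : (affineSpan ℝ C).direction < ⊤ := by
      rw [lt_top_iff_ne_top]
      intro h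
      exact hi ((AffineSubspace.direction_eq_top_iff_of_nonempty
        ⟨c0, subset_affineSpan ℝ C hc0⟩).1 h)
    obtain ⟨φ, hφ, hker⟩ := Submodule.exists_le_ker_of_lt_top _ hdir
    have hcc : ∀ c ∈ C, φ c = φ c0 := by
      intro c hc
      have : c -ᵥ c0 ∈ (affineSpan ℝ C).direction :=
        AffineSubspace.vsub_mem_direction (subset_affineSpan ℝ C hc) (subset_affineSpan ℝ C hc0)
      have := hker this
      rw [LinearMap.mem_ker, vsub_eq_sub, map_sub, sub_eq_zero] at this
      exact this
    refine ⟨LinearMap.toContinuousLinearMap φ, ?_, ?_⟩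
    · intro h; apply hφ; ext v; simpa using congrArg (fun g => g v) h
    · have h2 : closure C ⊆ {y | (LinearMap.toContinuousLinearMap φ) y = φ c0} :=
        closure_minimal (fun a ha => hcc a ha) (isClosed_eq (ContinuousLinearMap.continuous _) continuous_const)
      intro c hc
      have := h2 hxc
      simp only [mem_ofPred_eq] at this
      rw [this]
      exact (hcc c hc).le

theorem aux_integral_mem {Ω : Type} [MeasurableSpace Ω] (μ : Measure Ω) [IsProbabilityMeasure μ] :
    ∀ (n : ℕ) (E : Type) [NormedAddCommGroup E] [NormedSpace ℝ E]
    [FiniteDimensional ℝ E] (C : Set E) (X : Ω → E), Module.finrank ℝ E = n → Convex ℝ C →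
    Integrable X μ → (∀ᵐ ω ∂μ, X ω ∈ C) → ∫ ω, X ω ∂μ ∈ C := by
  intro n
  induction n using Nat.strong_induction_on with
  | _ n ih =>
  intro E _ _ _ C X hn hC hX hXC
  by_contra hx
  have hne : C.Nonempty := by
    obtain ⟨ω, h⟩ := hXC.exists
    exact ⟨_, h⟩
  have hxc : ∫ ω, X ω ∂μ ∈ closure C :=
    hC.closure.integral_mem isClosed_closure (hXC.mono fun ω h => subset_closure h) hX
  obtain ⟨L, hL0, hL⟩ := aux_weak_sep hC hne hx hxc
  set M := ∫ ω, X ω ∂μ with hM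
  have hLX : ∀ᵐ ω ∂μ, L (X ω) = L M := by
    have h0 : ∫ ω, (L M - L (X ω)) ∂μ = 0 := by
      rw [integral_sub (integrable_const _) (L.integrable_comp hX), L.integral_comp_comm hX]
      simp [hM]
    have := (integral_eq_zero_iff_of_nonneg_ae (hXC.mono fun ω h => sub_nonneg.2 (hL _ h))
      ((integrable_const _).sub (L.integrable_comp hX))).1 h0
    filter_upwards [this] with ω h
    simp only [Pi.zero_apply] at h
    linarith
  obtain ⟨p, hp⟩ := Submodule.ClosedComplemented.of_finiteDimensional (L.toLinearMap.ker)
  have hlt : Module.finrank ℝ (L.toLinearMap.ker) < n := by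
    rw [← hn]
    apply Submodule.finrank_lt
    intro h
    apply hL0
    ext v
    have : v ∈ L.toLinearMap.ker := h ▸ Submodule.mem_top
    simpa using this
  have key := ih _ hlt (L.toLinearMap.ker) {y | M + (y : E) ∈ C} (fun ω => p (X ω - M)) rfl ?_ ?_ ?_
  · have h0 : ∫ ω, p (X ω - M) ∂μ = 0 := by
      have hi : Integrable (fun ω => X ω - M) μ := hX.sub (integrable_const _)
      rw [p.integral_comp_comm hi,
        integral_sub hX (integrable_const _)]
      simp [hM]
    rw [h0] at key
    simp only [mem_ofPred_eq, ZeroMemClass.coe_zero, add_zero] at key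
    exact hx key
  · intro a ha b hb s t hs ht hst
    simp only [mem_ofPred_eq] at ha hb ⊢
    have := hC ha hb hs ht hst
    convert this using 1
    have : M = (s + t) • M := by rw [hst, one_smul]
    conv_lhs => rw [this]
    push_cast
    module
  · exact p.integrable_comp (hX.sub (integrable_const _))
  · filter_upwards [hXC, hLX] with ω h1 h2
    have hk : X ω - M ∈ L.toLinearMap.ker := by simp [h2]
    have := hp ⟨_, hk⟩
    change M + ((p (X ω - M) : L.toLinearMap.ker) : E) ∈ C
    rw [this]
    simpa using h1

/-- One linear-programming style reduction of the support of a conic combination. -/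
theorem aux_reduce {ι E : Type} [AddCommGroup E] [Module ℝ E] [FiniteDimensional ℝ E]
    (u : ι → E) (h : ι → ℝ) (ℓ : E →ₗ[ℝ] ℝ) (hℓ : ∀ i, 0 < ℓ (u i)) :
    ∀ (n : ℕ) (S : Finset ι) (w : ι → ℝ), S.card = n → (∀ i, 0 ≤ w i) →
    ∃ (T : Finset ι) (w' : ι → ℝ), T ⊆ S ∧ T.card ≤ Module.finrank ℝ E ∧ (∀ i, 0 ≤ w' i) ∧
      ∑ i ∈ T, w' i • u i = ∑ i ∈ S, w i • u i ∧
      ∑ i ∈ T, w' i * h i ≤ ∑ i ∈ S, w i * h i := by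
  intro n
  induction n using Nat.strong_induction_on with
  | _ n ih =>
  intro S w hS hw
  by_cases hc : S.card ≤ Module.finrank ℝ E
  · exact ⟨S, w, subset_rfl, hc, hw, rfl, le_rfl⟩
  push Not at hc
  have hdep : ∃ c : ι → ℝ, ∑ i ∈ S, c i • u i = 0 ∧ (∃ i ∈ S, c i ≠ 0) := by
    have hnl : ¬ LinearIndependent ℝ (fun i : S => u i) := by
      intro hli
      have := hli.fintype_card_le_finrank
      simp at this
      omega
    rw [Fintype.not_linearIndependent_iff] at hnl
    obtain ⟨g, hg, i, hi⟩ := hnl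
    refine ⟨fun j => if hj : j ∈ S then g ⟨j, hj⟩ else 0, ?_, i, i.2, ?_⟩
    · rw [← hg, ← Finset.sum_coe_sort]
      apply Finset.sum_congr rfl
      intro j _
      simp
    · simpa using hi
  have hdep2 : ∃ c : ι → ℝ, ∑ i ∈ S, c i • u i = 0 ∧ (∃ i ∈ S, c i ≠ 0) ∧
      ∑ i ∈ S, c i * h i ≤ 0 := by
    obtain ⟨c, h1, i, hi, h2⟩ := hdep
    rcases le_total (∑ i ∈ S, c i * h i) 0 with h3 | h3
    · exact ⟨c, h1, ⟨i, hi, h2⟩, h3⟩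
    · refine ⟨fun i => - c i, ?_, ⟨i, hi, by simpa using h2⟩, ?_⟩
      · simp [neg_smul, h1]
      · simpa using h3
  obtain ⟨c, hcu, ⟨i0, hi0, hci0⟩, hch⟩ := hdep2
  have hneg : ∃ i ∈ S, c i < 0 := by
    by_contra hno
    push Not at hno
    have h0 : ∑ i ∈ S, c i * ℓ (u i) = 0 := by
      have := congrArg ℓ hcu
      simpa using this
    rw [Finset.sum_eq_zero_iff_of_nonneg (fun i hi => mul_nonneg (hno i hi) (hℓ i).le)] at h0
    have := h0 i0 hi0
    rcases mul_eq_zero.1 this with h | h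
    · exact hci0 h
    · exact (hℓ i0).ne' h
  have hN : (S.filter (fun i => c i < 0)).Nonempty := by
    obtain ⟨i, hi, h⟩ := hneg
    exact ⟨i, by simp [hi, h]⟩
  obtain ⟨k, hk, hmin⟩ := Finset.exists_min_image _ (fun i => w i / (- c i)) hN
  simp only [Finset.mem_filter] at hk hmin
  set τ := w k / (- c k) with hτ
  have hτ0 : 0 ≤ τ := div_nonneg (hw k) (by linarith [hk.2])
  have hwk : w k + τ * c k = 0 := by
    rw [hτ]; have := hk.2.ne; field_simp; ring
  have hw'0 : ∀ i ∈ S, 0 ≤ w i + τ * c i := by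
    intro i hi
    rcases lt_or_ge (c i) 0 with h | h
    · have := hmin i ⟨hi, h⟩
      rw [le_div_iff₀ (by linarith)] at this
      linarith
    · have := mul_nonneg hτ0 h
      linarith [hw i]
  obtain ⟨T, w', hT, hTc, hw', hu', hh'⟩ := ih (S.erase k).card
    (by rw [← hS]; exact Finset.card_erase_lt_of_mem hk.1) (S.erase k)
    (fun i => if i ∈ S then w i + τ * c i else 0) rfl (by
      intro i
      split_ifs with hi
      · exact hw'0 i hi
      · exact le_rfl)
  refine ⟨T, w', hT.trans (Finset.erase_subset _ _), hTc, hw', ?_, ?_⟩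
  · rw [hu', Finset.sum_erase]
    · rw [Finset.sum_congr rfl (g := fun i => w i • u i + τ • (c i • u i))]
      · rw [Finset.sum_add_distrib, ← Finset.smul_sum, hcu, smul_zero, add_zero]
      · intro i hi
        rw [if_pos hi, add_smul, mul_smul]
    · rw [if_pos hk.1, hwk, zero_smul]
  · refine hh'.trans ?_
    rw [Finset.sum_erase]
    · rw [Finset.sum_congr rfl (g := fun i => w i * h i + τ * (c i * h i))]
      · rw [Finset.sum_add_distrib, ← Finset.mul_sum]
        have := mul_nonpos_of_nonneg_of_nonpos hτ0 hch
        linarith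
      · intro i hi
        rw [if_pos hi]; ring
    · rw [if_pos hk.1, hwk, zero_mul]

theorem aux_limAtZero_ne_bot {f : ℝ → ℝ} (hf : ConvexOn ℝ (Set.Ioi 0) f) (hf1 : f 1 = 0) :
    limAtZero f ≠ ⊥ := by
  have : ((-|f 2| : ℝ) : EReal) ≤ limAtZero f := by
    unfold limAtZero
    refine le_limsup_of_frequently_le ?_ (by isBoundedDefault)
    · apply Eventually.frequently
      have : Ioo (0:ℝ) 1 ∈ nhdsWithin (0:ℝ) (Ioi 0) := Ioo_mem_nhdsGT one_pos
      filter_upwards [this] with x hx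
      have h2 : (0:ℝ) < 2 - x := by linarith [hx.2]
      have hcv := hf.2
      have h := @hcv x hx.1 2 (by simp) (1 / (2 - x)) ((1 - x) / (2 - x)) (by positivity)
        (div_nonneg (by linarith [hx.2]) h2.le) (by field_simp; ring)
      have e : (1 / (2 - x)) • x + ((1 - x) / (2 - x)) • (2:ℝ) = 1 := by
        simp only [smul_eq_mul]; field_simp; ring
      rw [e, hf1, smul_eq_mul, smul_eq_mul] at h
      have h3 : 0 ≤ f x + (1 - x) * f 2 := by
        rw [div_mul_eq_mul_div, div_mul_eq_mul_div, ← add_div] at h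
        have := mul_nonneg h2.le h
        rwa [mul_div_cancel₀ _ h2.ne', one_mul] at this
      have h4 : (1 - x) * f 2 ≤ |f 2| := by
        have := le_abs_self (f 2)
        have := abs_nonneg (f 2)
        nlinarith [hx.1, hx.2]
      exact_mod_cast (by linarith : -|f 2| ≤ f x)
  intro h
  rw [h] at this
  exact absurd this (by simp [-EReal.coe_neg])

theorem aux_derivAtTop_ne_bot {f : ℝ → ℝ} (hf : ConvexOn ℝ (Set.Ioi 0) f) (hf1 : f 1 = 0) :
    derivAtTop f ≠ ⊥ := by
  have : ((-(2 * |f (1/2)|) : ℝ) : EReal) ≤ derivAtTop f := by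
    unfold derivAtTop
    refine le_limsup_of_frequently_le ?_ (by isBoundedDefault)
    · apply Eventually.frequently
      filter_upwards [eventually_gt_atTop (1:ℝ)] with x hx
      have h2 : (0:ℝ) < x - 1/2 := by linarith
      have hcv := hf.2
      have h := @hcv (1/2) (by simp) x (by simp; linarith)
        ((x - 1) / (x - 1/2)) ((1/2) / (x - 1/2))
        (div_nonneg (by linarith) h2.le) (by positivity) (by rw [← add_div, div_eq_one_iff_eq h2.ne']; ring)
      have e : ((x - 1) / (x - 1/2)) • (1/2:ℝ) + ((1/2) / (x - 1/2)) • x = 1 := by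
        simp only [smul_eq_mul]
        rw [div_mul_eq_mul_div, div_mul_eq_mul_div, ← add_div, div_eq_one_iff_eq h2.ne']; ring
      rw [e, hf1, smul_eq_mul, smul_eq_mul] at h
      have h3 : 0 ≤ (x - 1) * f (1/2) + (1/2) * f x := by
        rw [div_mul_eq_mul_div, div_mul_eq_mul_div, ← add_div] at h
        have := mul_nonneg h2.le h
        rwa [mul_div_cancel₀ _ h2.ne'] at this
      have h4 : (x - 1) * f (1/2) ≤ x * |f (1/2)| := by
        have := le_abs_self (f (1/2))
        have := abs_nonneg (f (1/2))
        nlinarith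
      have : -(2 * |f (1/2)|) ≤ f x / x := by
        rw [le_div_iff₀ (by linarith)]
        linarith
      exact_mod_cast this
  intro h
  rw [h] at this
  exact absurd this (by simp [-EReal.coe_neg])
/-- The real-valued extension of `f` to `[0,∞]`. -/
def fhat (f : ℝ → ℝ) (ρ : ℝ≥0∞) : ℝ :=
  if ρ = 0 then (limAtZero f).toReal else if ρ = ⊤ then (derivAtTop f).toReal else f ρ.toReal

/-- The version of `fhat` without special treatment of `⊤`. -/
def fhat0 (f : ℝ → ℝ) (ρ : ℝ≥0∞) : ℝ :=
  if ρ = 0 then (limAtZero f).toReal else f ρ.toReal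

theorem aux_mul_coe {a : EReal} (ha : a ≠ ⊥) {b : ℝ≥0∞} (hb : b ≠ ⊤) (h : a = ⊤ → b = 0) :
    a * (b : EReal) = ((a.toReal * b.toReal : ℝ) : EReal) := by
  by_cases hat : a = ⊤
  · simp [h hat]
  · lift a to ℝ using ⟨hat, ha⟩
    lift b to ℝ≥0 using hb
    simp
    rfl

theorem aux_mul_ne_bot {a : EReal} (ha : a ≠ ⊥) {b : ℝ≥0∞} (hb : b ≠ ⊤) :
    a * (b : EReal) ≠ ⊥ := by
  by_cases hat : a = ⊤
  · by_cases h0 : b = 0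
    · simp [h0]
    · rw [hat, EReal.top_mul_of_pos]
      · simp
      · rw [← EReal.coe_ennreal_zero, EReal.coe_ennreal_lt_coe_ennreal_iff]
        exact pos_iff_ne_zero.2 h0
  · rw [aux_mul_coe ha hb (fun h => absurd h hat)]
    exact EReal.coe_ne_bot _

theorem aux_mul_eq_top {a : EReal} (ha : a = ⊤) {b : ℝ≥0∞} (hb : b ≠ 0) :
    a * (b : EReal) = ⊤ := by
  rw [ha, EReal.top_mul_of_pos]
  rw [← EReal.coe_ennreal_zero, EReal.coe_ennreal_lt_coe_ennreal_iff]
  exact pos_iff_ne_zero.2 hb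

theorem aux_fDiv_eq {f : ℝ → ℝ} (hf : ConvexOn ℝ (Set.Ioi 0) f) (hf1 : f 1 = 0)
    {Ω : Type} [MeasurableSpace Ω] (P Q : Measure Ω) [IsProbabilityMeasure P]
    [IsProbabilityMeasure Q] (hi : Integrable (fun x => fhat0 f (P.rnDeriv Q x)) Q)
    (h0 : limAtZero f = ⊤ → Q {x | P.rnDeriv Q x = 0} = 0)
    (ht : derivAtTop f = ⊤ → P.singularPart Q Set.univ = 0) :
    fDiv f P Q = ((∫ x, fhat0 f (P.rnDeriv Q x) ∂Q +
      (derivAtTop f).toReal * (P.singularPart Q Set.univ).toReal : ℝ) : EReal) := by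
  have hm : MeasurableSet {x | P.rnDeriv Q x ≠ 0} :=
    (Measure.measurable_rnDeriv P Q) (measurableSet_singleton 0).compl
  have hm0 : MeasurableSet {x | P.rnDeriv Q x = 0} :=
    (Measure.measurable_rnDeriv P Q) (measurableSet_singleton 0)
  have hc : {x | P.rnDeriv Q x ≠ 0}ᶜ = {x | P.rnDeriv Q x = 0} := by ext; simp
  have hE : EqOn (fun x => f (P.rnDeriv Q x).toReal) (fun x => fhat0 f (P.rnDeriv Q x))
      {x | P.rnDeriv Q x ≠ 0} := by
    intro x hx
    simp only [mem_ofPred_eq] at hx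
    simp [fhat0, hx]
  have hE0 : EqOn (fun x => fhat0 f (P.rnDeriv Q x)) (fun x => (limAtZero f).toReal)
      {x | P.rnDeriv Q x = 0} := by
    intro x hx
    simp only [mem_ofPred_eq] at hx
    simp [fhat0, hx]
  have hint : Integrable (fun x => f ((P.rnDeriv Q x).toReal))
      (Q.restrict {x | P.rnDeriv Q x ≠ 0}) :=
    (integrableOn_congr_fun hE hm).2 hi.integrableOn
  unfold fDiv
  rw [if_pos hint, aux_mul_coe (aux_limAtZero_ne_bot hf hf1) (measure_ne_top _ _) h0,
    aux_mul_coe (aux_derivAtTop_ne_bot hf hf1) (measure_ne_top _ _) ht]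
  rw [← EReal.coe_add, ← EReal.coe_add]
  congr 2
  rw [← integral_add_compl hm hi, hc, setIntegral_congr_fun hm hE, setIntegral_congr_fun hm0 hE0]
  simp [Measure.real, mul_comm]

theorem aux_fDiv_lt_top {f : ℝ → ℝ} (hf : ConvexOn ℝ (Set.Ioi 0) f) (hf1 : f 1 = 0)
    {Ω : Type} [MeasurableSpace Ω] (P Q : Measure Ω) [IsProbabilityMeasure P]
    [IsProbabilityMeasure Q] (h : fDiv f P Q < ⊤) :
    Integrable (fun x => fhat0 f (P.rnDeriv Q x)) Q ∧
    (limAtZero f = ⊤ → Q {x | P.rnDeriv Q x = 0} = 0) ∧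
    (derivAtTop f = ⊤ → P.singularPart Q Set.univ = 0) := by
  have hm : MeasurableSet {x | P.rnDeriv Q x ≠ 0} :=
    (Measure.measurable_rnDeriv P Q) (measurableSet_singleton 0).compl
  have hm0 : MeasurableSet {x | P.rnDeriv Q x = 0} :=
    (Measure.measurable_rnDeriv P Q) (measurableSet_singleton 0)
  have hc : {x | P.rnDeriv Q x ≠ 0}ᶜ = {x | P.rnDeriv Q x = 0} := by ext; simp
  have hE : EqOn (fun x => f (P.rnDeriv Q x).toReal) (fun x => fhat0 f (P.rnDeriv Q x))
      {x | P.rnDeriv Q x ≠ 0} := by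
    intro x hx
    simp only [mem_ofPred_eq] at hx
    simp [fhat0, hx]
  have hE0 : EqOn (fun x => fhat0 f (P.rnDeriv Q x)) (fun x => (limAtZero f).toReal)
      {x | P.rnDeriv Q x = 0} := by
    intro x hx
    simp only [mem_ofPred_eq] at hx
    simp [fhat0, hx]
  unfold fDiv at h
  have hb0 := aux_mul_ne_bot (aux_limAtZero_ne_bot hf hf1)
    (measure_ne_top Q {x | P.rnDeriv Q x = 0})
  have hbt := aux_mul_ne_bot (aux_derivAtTop_ne_bot hf hf1)
    (measure_ne_top (P.singularPart Q) Set.univ)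
  set A : EReal := (if Integrable (fun x => f ((Measure.rnDeriv P Q x).toReal))
      (Q.restrict {x | Measure.rnDeriv P Q x ≠ 0})
   then ((∫ x in {x | Measure.rnDeriv P Q x ≠ 0},
       f ((Measure.rnDeriv P Q x).toReal) ∂Q : ℝ) : EReal)
   else (⊤ : EReal)) with hA
  have hbA : A ≠ ⊥ := by
    rw [hA]; split_ifs
    · exact EReal.coe_ne_bot _
    · simp
  have h12 : A + limAtZero f * (Q {x | P.rnDeriv Q x = 0} : EReal) ≠ ⊥ := by
    rw [Ne, EReal.add_eq_bot_iff]; tauto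
  refine ⟨?_, ?_, ?_⟩
  · by_contra hni
    have : ¬ Integrable (fun x => f ((P.rnDeriv Q x).toReal))
      (Q.restrict {x | P.rnDeriv Q x ≠ 0}) := by
      intro hint
      apply hni
      rw [← integrableOn_univ, ← union_compl_self {x | P.rnDeriv Q x ≠ 0}, hc]
      refine IntegrableOn.union ((integrableOn_congr_fun hE hm).1 hint) ?_
      exact (integrableOn_congr_fun hE0 hm0).2 (integrable_const _)
    rw [if_neg this] at hA
    rw [hA, EReal.top_add_of_ne_bot hb0, EReal.top_add_of_ne_bot hbt] at h
    exact lt_irrefl _ h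
  · intro hl
    by_contra hne
    rw [aux_mul_eq_top hl hne, EReal.add_top_of_ne_bot hbA, EReal.top_add_of_ne_bot hbt] at h
    exact lt_irrefl _ h
  · intro hl
    by_contra hne
    rw [aux_mul_eq_top hl hne, EReal.add_top_of_ne_bot h12] at h
    exact lt_irrefl _ h

/-- The set of admissible likelihood ratios for `f`. -/
def good (f : ℝ → ℝ) (ρ : ℝ≥0∞) : Prop :=
  (ρ = 0 → limAtZero f ≠ ⊤) ∧ (ρ = ⊤ → derivAtTop f ≠ ⊤)

/-- First coordinate of an atom. -/
def pco (ρ : ℝ≥0∞) : ℝ := if ρ = ⊤ then 1 else ρ.toReal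
/-- Second coordinate of an atom. -/
def qco (ρ : ℝ≥0∞) : ℝ := if ρ = ⊤ then 0 else 1

theorem aux_finite (n : ℕ) (W : Fin n → ℝ) (hW : ∀ j, 0 ≤ W j) (ρ : Fin n → ℝ≥0∞)
    (hp : ∑ j, W j * pco (ρ j) = 1) (hq : ∑ j, W j * qco (ρ j) = 1) :
    ∃ P Q : Measure (Fin n), IsProbabilityMeasure P ∧ IsProbabilityMeasure Q ∧
      ∀ f : ℝ → ℝ, ConvexOn ℝ (Set.Ioi 0) f → f 1 = 0 → (∀ j, good f (ρ j)) →
        fDiv f P Q = ((∑ j, W j * fhat f (ρ j) : ℝ) : EReal) := by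
  set Q : Measure (Fin n) := Measure.count.withDensity
    (fun j => if ρ j = ⊤ then 0 else ENNReal.ofReal (W j)) with hQ
  set s : Measure (Fin n) := Measure.count.withDensity
    (fun j => if ρ j = ⊤ then ENNReal.ofReal (W j) else 0) with hs
  set R : Fin n → ℝ≥0∞ := fun j => if ρ j = ⊤ then 0 else ρ j with hR
  have hQj : ∀ j, Q {j} = if ρ j = ⊤ then 0 else ENNReal.ofReal (W j) := by
    intro j
    rw [hQ, withDensity_apply _ (measurableSet_singleton j), lintegral_singleton]
    simp
  have hsj : ∀ j, s {j} = if ρ j = ⊤ then ENNReal.ofReal (W j) else 0 := by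
    intro j
    rw [hs, withDensity_apply _ (measurableSet_singleton j), lintegral_singleton]
    simp
  have hQu : Q univ = 1 := by
    rw [hQ, withDensity_apply _ MeasurableSet.univ, Measure.restrict_univ, lintegral_count,
      tsum_fintype, ← ENNReal.ofReal_one, ← hq, ENNReal.ofReal_sum_of_nonneg]
    · apply Finset.sum_congr rfl
      intro j _
      unfold qco
      split_ifs <;> simp
    · intro j _
      unfold qco
      split_ifs <;> simp [hW j]
  have hsu : s univ = ENNReal.ofReal (∑ j, if ρ j = ⊤ then W j else 0) := by
    rw [hs, withDensity_apply _ MeasurableSet.univ, Measure.restrict_univ, lintegral_count,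
      tsum_fintype, ENNReal.ofReal_sum_of_nonneg]
    · apply Finset.sum_congr rfl
      intro j _
      split_ifs <;> simp
    · intro j _
      split_ifs <;> simp [hW j]
  have hnn : ∀ j, 0 ≤ if ρ j = ⊤ then W j else 0 := by
    intro j; split_ifs <;> simp [hW j]
  have hRu : (Q.withDensity R) univ = ENNReal.ofReal (∑ j, if ρ j = ⊤ then 0 else W j * (ρ j).toReal) := by
    rw [withDensity_apply _ MeasurableSet.univ, Measure.restrict_univ, lintegral_fintype,
      ENNReal.ofReal_sum_of_nonneg]
    · apply Finset.sum_congr rfl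
      intro j _
      rw [hQj]
      simp only [hR]
      split_ifs with h
      · simp
      · rw [ENNReal.ofReal_mul (hW j), ENNReal.ofReal_toReal h, mul_comm]
    · intro j _
      split_ifs
      · simp
      · exact mul_nonneg (hW j) ENNReal.toReal_nonneg
  have hQp : IsProbabilityMeasure Q := ⟨hQu⟩
  have hPp : IsProbabilityMeasure (s + Q.withDensity R) := by
    constructor
    rw [Measure.add_apply, hsu, hRu, ← ENNReal.ofReal_add (Finset.sum_nonneg fun j _ => hnn j),
      ← Finset.sum_add_distrib, ← ENNReal.ofReal_one, ← hp]
    · congr 1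
      apply Finset.sum_congr rfl
      intro j _
      unfold pco
      split_ifs <;> simp
    · apply Finset.sum_nonneg
      intro j _
      split_ifs
      · simp
      · exact mul_nonneg (hW j) ENNReal.toReal_nonneg
  have hsQ : s ⟂ₘ Q := by
    refine ⟨{j | ρ j ≠ ⊤}, MeasurableSet.of_discrete, ?_, ?_⟩
    · rw [hs, withDensity_apply _ MeasurableSet.of_discrete]
      rw [setLIntegral_congr_fun MeasurableSet.of_discrete (g := fun _ => 0)]
      · simp
      · intro j hj
        simp only [mem_ofPred_eq] at hj
        simp [hj]
    · rw [hQ, withDensity_apply _ MeasurableSet.of_discrete]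
      rw [setLIntegral_congr_fun MeasurableSet.of_discrete (g := fun _ => 0)]
      · simp
      · intro j hj
        simp only [mem_compl_iff, mem_ofPred_eq, not_not] at hj
        simp [hj]
  have hRm : Measurable R := measurable_of_finite _
  set P := s + Q.withDensity R with hP
  have hrn : R =ᵐ[Q] P.rnDeriv Q := Measure.eq_rnDeriv hRm hsQ hP
  have hsp : s = P.singularPart Q := Measure.eq_singularPart hRm hsQ hP
  refine ⟨P, Q, hPp, hQp, ?_⟩
  intro f hf hf1 hg
  rw [aux_fDiv_eq hf hf1 P Q (Integrable.of_finite) ?_ ?_]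
  · congr 1
    rw [← hsp, hsu, ENNReal.toReal_ofReal (Finset.sum_nonneg fun j _ => hnn j)]
    rw [integral_congr_ae (g := fun x => fhat0 f (R x)) (hrn.mono fun x hx => by
      simp only [hx])]
    rw [integral_fintype (Integrable.of_finite), Finset.mul_sum, ← Finset.sum_add_distrib]
    apply Finset.sum_congr rfl
    intro j _
    rw [Measure.real, hQj]
    simp only [hR, smul_eq_mul, fhat0, fhat]
    by_cases h : ρ j = ⊤
    · simp [h, mul_comm]
    · simp [h, hW j]
  · intro hl
    rw [measure_congr (t := {x | R x = 0})]
    · rw [hQ, withDensity_apply _ MeasurableSet.of_discrete]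
      rw [setLIntegral_congr_fun MeasurableSet.of_discrete (g := fun _ => 0)]
      · simp
      · intro j hj
        simp only [mem_ofPred_eq, hR] at hj
        by_cases h : ρ j = ⊤
        · simp [h]
        · rw [if_neg h] at hj
          exact absurd hl ((hg j).1 hj)
    · filter_upwards [hrn] with x hx
      change (P.rnDeriv Q x = 0) = (R x = 0)
      rw [hx]
  · intro hl
    rw [← hsp, hsu, Finset.sum_eq_zero]
    · simp
    · intro j _
      rw [if_neg]
      intro h
      exact (hg j).2 h hl
theorem aux_pco_qco (ρ : ℝ≥0∞) : 0 < pco ρ + qco ρ := by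
  unfold pco qco
  split_ifs
  · norm_num
  · have : 0 ≤ ρ.toReal := ENNReal.toReal_nonneg
    linarith

theorem aux_fhat_eq (f : ℝ → ℝ) {ρ : ℝ≥0∞} (h : ρ ≠ ⊤) : fhat f ρ = fhat0 f ρ := by
  simp [fhat, fhat0, h]

theorem aux_good_ae {f : ℝ → ℝ} {Ω : Type} [MeasurableSpace Ω] (P Q : Measure Ω)
    [IsProbabilityMeasure P] [IsProbabilityMeasure Q]
    (h0 : limAtZero f = ⊤ → Q {x | P.rnDeriv Q x = 0} = 0) :
    ∀ᵐ x ∂Q, good f (P.rnDeriv Q x) := by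
  have ht : ∀ᵐ x ∂Q, P.rnDeriv Q x ≠ ⊤ := Measure.rnDeriv_ne_top P Q
  by_cases hl : limAtZero f = ⊤
  · have : ∀ᵐ x ∂Q, P.rnDeriv Q x ≠ 0 := by
      rw [ae_iff]
      simpa using h0 hl
    filter_upwards [ht, this] with x h1 h2
    exact ⟨fun h => absurd h h2, fun h => absurd h h1⟩
  · filter_upwards [ht] with x h1
    exact ⟨fun _ => hl, fun h => absurd h h1⟩

theorem aux_good_one (f : ℝ → ℝ) : good f 1 :=
  ⟨fun h => absurd h one_ne_zero, fun h => absurd h ENNReal.one_ne_top⟩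

theorem aux_main (m : ℕ) (f : ℝ → ℝ) (fs : Fin m → ℝ → ℝ)
    (hf : ConvexOn ℝ (Set.Ioi 0) f) (hf1 : f 1 = 0)
    (hfs : ∀ i, ConvexOn ℝ (Set.Ioi 0) (fs i)) (hfs1 : ∀ i, fs i 1 = 0)
    {Ω : Type} [MeasurableSpace Ω] (P Q : Measure Ω) [IsProbabilityMeasure P]
    [IsProbabilityMeasure Q] (hfin : fDiv f P Q < ⊤) (hfins : ∀ i, fDiv (fs i) P Q < ⊤) :
    ∃ P' Q' : Measure (Fin (m + 2)), IsProbabilityMeasure P' ∧ IsProbabilityMeasure Q' ∧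
      (∀ i, fDiv (fs i) P' Q' = fDiv (fs i) P Q) ∧ fDiv f P' Q' ≤ fDiv f P Q := by
  obtain ⟨hi, h0, ht⟩ := aux_fDiv_lt_top hf hf1 P Q hfin
  have hh := fun i => aux_fDiv_lt_top (hfs i) (hfs1 i) P Q (hfins i)
  set r := P.rnDeriv Q with hr
  set σ := P.singularPart Q Set.univ with hσ
  set G : Set ℝ≥0∞ := {ρ | good f ρ ∧ ∀ i, good (fs i) ρ} with hG
  set u : ℝ≥0∞ → ℝ × ℝ × (Fin m → ℝ) :=
    fun ρ => (pco ρ, qco ρ, fun i => fhat (fs i) ρ) with hu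
  set C := convexHull ℝ ((fun ρ => (u ρ, fhat f ρ)) '' G) with hC
  set X : Ω → (ℝ × ℝ × (Fin m → ℝ)) × ℝ :=
    fun x => (((r x).toReal, 1, fun i => fhat0 (fs i) (r x)), fhat0 f (r x)) with hX
  have hri : Integrable (fun x => (r x).toReal) Q := Measure.integrable_toReal_rnDeriv
  have hpi : Integrable (fun x => fun i => fhat0 (fs i) (r x)) Q :=
    Integrable.of_eval fun i => (hh i).1
  have hXi : Integrable X Q :=
    (hri.prodMk ((integrable_const (1:ℝ)).prodMk hpi)).prodMk hi
  have hXC : ∀ᵐ x ∂Q, X x ∈ C := by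
    have hgs : ∀ᵐ x ∂Q, ∀ i, good (fs i) (r x) :=
      ae_all_iff.2 fun i => aux_good_ae P Q (hh i).2.1
    filter_upwards [Measure.rnDeriv_ne_top P Q, aux_good_ae P Q h0, hgs] with x h1 h2 h3
    apply subset_convexHull
    refine ⟨r x, ⟨h2, h3⟩, ?_⟩
    have h1' : r x ≠ ⊤ := h1
    simp only [hu, hX, pco, qco, if_neg h1', aux_fhat_eq _ h1']
  have hmem := aux_integral_mem Q _ _ C X rfl (convex_convexHull ℝ _) hXi hXC
  have hXint : ∫ x, X x ∂Q = ((∫ x, (r x).toReal ∂Q, 1, fun i => ∫ x, fhat0 (fs i) (r x) ∂Q),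
      ∫ x, fhat0 f (r x) ∂Q) := by
    rw [hX, integral_pair (hri.prodMk ((integrable_const (1:ℝ)).prodMk hpi)) hi,
      integral_pair hri ((integrable_const (1:ℝ)).prodMk hpi),
      integral_pair (integrable_const (1:ℝ)) hpi]
    have : ∫ x, (fun i => fhat0 (fs i) (r x)) ∂Q = fun i => ∫ x, fhat0 (fs i) (r x) ∂Q := by
      ext i
      exact eval_integral (fun i => (hh i).1) i
    rw [this]
    simp
  rw [hXint, hC, mem_convexHull_iff_exists_fintype] at hmem
  obtain ⟨ι, _, w, z, hw0, hw1, hz, hwz⟩ := hmem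
  choose ρ hρG hρz using hz
  have hwu : ∑ k, w k • u (ρ k) =
      (∫ x, (r x).toReal ∂Q, 1, fun i => ∫ x, fhat0 (fs i) (r x) ∂Q) := by
    have := congrArg Prod.fst hwz
    rw [Prod.fst_sum] at this
    simpa [← hρz] using this
  have hwh : ∑ k, w k * fhat f (ρ k) = ∫ x, fhat0 f (r x) ∂Q := by
    have := congrArg Prod.snd hwz
    rw [Prod.snd_sum] at this
    simpa [← hρz] using this
  -- add the atom at infinity
  set ρ' : Option ι → ℝ≥0∞ := fun o => o.elim (if σ = 0 then 1 else ⊤) ρ with hρ'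
  set w1 : Option ι → ℝ := fun o => o.elim σ.toReal w with hw1'
  have hρ'G : ∀ o, ρ' o ∈ G := by
    intro o
    cases o with
    | some k => exact hρG k
    | none =>
      simp only [hρ', Option.elim]
      split_ifs with h
      · exact ⟨aux_good_one _, fun i => aux_good_one _⟩
      · refine ⟨⟨fun h => absurd h ENNReal.top_ne_zero, fun _ h' => h (ht h')⟩, fun i =>
          ⟨fun h => absurd h ENNReal.top_ne_zero, fun _ h' => h ((hh i).2.2 h')⟩⟩
  have hnone : ∀ ψ : ℝ≥0∞ → ℝ, σ.toReal * ψ (ρ' none) = ψ ⊤ * σ.toReal := by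
    intro ψ
    simp only [hρ', Option.elim]
    split_ifs with h
    · simp [h]
    · ring
  have hw1n : ∀ o, 0 ≤ w1 o := by
    intro o
    cases o with
    | some k => exact hw0 k
    | none => exact ENNReal.toReal_nonneg
  obtain ⟨T, w', -, hTc, hw', hu', hh'⟩ := aux_reduce (fun o => u (ρ' o)) (fun o => fhat f (ρ' o))
    (LinearMap.fst ℝ ℝ (ℝ × (Fin m → ℝ)) +
      (LinearMap.fst ℝ ℝ (Fin m → ℝ)).comp (LinearMap.snd ℝ ℝ (ℝ × (Fin m → ℝ))))
    (fun o => by simpa [hu] using aux_pco_qco (ρ' o)) _ Finset.univ w1 rfl hw1n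
  rw [Fintype.sum_option] at hu' hh'
  have hfr : Module.finrank ℝ (ℝ × ℝ × (Fin m → ℝ)) = m + 2 := by
    simp; ring
  rw [hfr] at hTc
  have e1 : ∑ o ∈ T, w' o * pco (ρ' o) = 1 := by
    have := congrArg Prod.fst hu'
    have h2 := congrArg Prod.fst hwu
    simp only [Prod.fst_sum, Prod.fst_add, Prod.smul_fst, smul_eq_mul, hu] at this h2
    rw [this]
    change σ.toReal * pco (ρ' none) + ∑ k, w k * pco (ρ k) = 1
    rw [h2, hnone pco, Measure.integral_toReal_rnDeriv']
    simp [pco, Measure.real, hσ]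
  have e2 : ∑ o ∈ T, w' o * qco (ρ' o) = 1 := by
    have := congrArg (fun a => a.2.1) hu'
    have h2 := congrArg (fun a => a.2.1) hwu
    simp only [Prod.fst_sum, Prod.snd_sum, Prod.fst_add, Prod.snd_add, Prod.smul_fst,
      Prod.smul_snd, smul_eq_mul, hu] at this h2
    rw [this]
    change σ.toReal * qco (ρ' none) + ∑ k, w k * qco (ρ k) = 1
    rw [h2, hnone qco]
    simp [qco]
  have e3 : ∀ i, ∑ o ∈ T, w' o * fhat (fs i) (ρ' o) =
      ∫ x, fhat0 (fs i) (r x) ∂Q + (derivAtTop (fs i)).toReal * σ.toReal := by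
    intro i
    have := congrArg (fun a => a.2.2 i) hu'
    have h2 := congrArg (fun a => a.2.2 i) hwu
    simp only [Prod.snd_sum, Prod.snd_add, Finset.sum_apply, Pi.add_apply, Pi.smul_apply,
      Prod.smul_snd, smul_eq_mul, hu] at this h2
    rw [this]
    change σ.toReal * fhat (fs i) (ρ' none) + ∑ k, w k * fhat (fs i) (ρ k) = _
    rw [h2, hnone (fhat (fs i)), add_comm]
    simp [fhat]
  have e4 : ∑ o ∈ T, w' o * fhat f (ρ' o) ≤
      ∫ x, fhat0 f (r x) ∂Q + (derivAtTop f).toReal * σ.toReal := by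
    refine hh'.trans (le_of_eq ?_)
    change σ.toReal * fhat f (ρ' none) + ∑ k, w k * fhat f (ρ k) = _
    rw [hwh, hnone (fhat f), add_comm]
    simp [fhat]
  -- transfer to `Fin (m + 2)`
  obtain ⟨e⟩ : Nonempty (T ↪ Fin (m + 2)) :=
    Function.Embedding.nonempty_of_card_le (by simpa using hTc)
  set W : Fin (m + 2) → ℝ := Function.extend e (fun o => w' o) (fun _ => 0) with hW
  set R : Fin (m + 2) → ℝ≥0∞ := Function.extend e (fun o => ρ' o) (fun _ => 1) with hR
  have hsum : ∀ ψ : ℝ≥0∞ → ℝ, ∑ j, W j * ψ (R j) = ∑ o ∈ T, w' o * ψ (ρ' o) := by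
    intro ψ
    rw [← Finset.sum_coe_sort T]
    symm
    apply Fintype.sum_of_injective e e.injective
    · intro j hj
      rw [hW, Function.extend_apply' _ _ _ (by simpa using hj), zero_mul]
    · intro o
      rw [hW, hR, e.injective.extend_apply, e.injective.extend_apply]
  have hW0 : ∀ j, 0 ≤ W j := by
    intro j
    by_cases hj : ∃ o, e o = j
    · obtain ⟨o, rfl⟩ := hj
      rw [hW, e.injective.extend_apply]
      exact hw' o
    · rw [hW, Function.extend_apply' _ _ _ hj]
  have hRG : ∀ j, R j ∈ G := by
    intro j
    by_cases hj : ∃ o, e o = j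
    · obtain ⟨o, rfl⟩ := hj
      rw [hR, e.injective.extend_apply]
      exact hρ'G o
    · rw [hR, Function.extend_apply' _ _ _ hj]
      exact ⟨aux_good_one _, fun i => aux_good_one _⟩
  obtain ⟨P', Q', hP', hQ', hD⟩ := aux_finite (m + 2) W hW0 R (by rw [hsum, e1])
    (by rw [hsum, e2])
  refine ⟨P', Q', hP', hQ', ?_, ?_⟩
  · intro i
    rw [hD (fs i) (hfs i) (hfs1 i) (fun j => (hRG j).2 i), hsum, e3,
      aux_fDiv_eq (hfs i) (hfs1 i) P Q (hh i).1 (hh i).2.1 (hh i).2.2]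
  · rw [hD f hf hf1 (fun j => (hRG j).1), hsum, aux_fDiv_eq hf hf1 P Q hi h0 ht]
    exact EReal.coe_le_coe_iff.2 e4

/-- **Theorem 1, second part (Guntuboyina–Saha–Schiebinger).**
If the divergences `D_{f_1}, …, D_{f_m}` are all finite, the infimum of `D_f(P‖Q)` over all
pairs of probability measures on all measurable spaces, subject to `D_{f_i}(P‖Q) ≥ D_i` for
all `i`, equals the same infimum restricted to pairs of probability measures on a set with
`m + 2` points. -/
theorem inf_fDiv_reduction (m : ℕ) (f : ℝ → ℝ) (fs : Fin m → ℝ → ℝ)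
    (hf : ConvexOn ℝ (Set.Ioi 0) f) (hf1 : f 1 = 0)
    (hfs : ∀ i, ConvexOn ℝ (Set.Ioi 0) (fs i)) (hfs1 : ∀ i, fs i 1 = 0)
    (hfin : ∀ i, sSup {x : EReal | ∃ pp : PMPair, x = fDiv (fs i) pp.P pp.Q} < ⊤)
    (D : Fin m → ℝ) (hD : ∀ i, 0 ≤ D i) :
    sInf {x : EReal | ∃ pp : PMPair,
        (∀ i, (D i : EReal) ≤ fDiv (fs i) pp.P pp.Q) ∧ x = fDiv f pp.P pp.Q} =
    sInf {x : EReal | ∃ P Q : Measure (Fin (m + 2)),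
        IsProbabilityMeasure P ∧ IsProbabilityMeasure Q ∧
        (∀ i, (D i : EReal) ≤ fDiv (fs i) P Q) ∧ x = fDiv f P Q} := by
  apply le_antisymm
  · apply sInf_le_sInf
    rintro x ⟨P, Q, hP, hQ, h, rfl⟩
    exact ⟨⟨Fin (m + 2), inferInstance, P, Q, hP, hQ⟩, h, rfl⟩
  · apply le_sInf
    rintro x ⟨pp, h, rfl⟩
    rcases eq_or_lt_of_le (le_top : fDiv f pp.P pp.Q ≤ ⊤) with htop | hlt
    · rw [htop]; exact le_top
    have := pp.probP
    have := pp.probQ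
    obtain ⟨P', Q', hP', hQ', h1, h2⟩ := aux_main m f fs hf hf1 hfs hfs1 pp.P pp.Q hlt
      (fun i => lt_of_le_of_lt (le_sSup (show _ ∈ {x : EReal | ∃ pp : PMPair, x = fDiv (fs i) pp.P pp.Q} from ⟨pp, rfl⟩)) (hfin i))
    exact sInf_le_of_le ⟨P', Q', hP', hQ', fun i => by rw [h1 i]; exact h i, rfl⟩ h2

end
end

section
/- For every convex function f:(0,∞)→ℝ with f(1)=0, the supremum of D_f(P‖Q) over all pairs of probability measures P, Q on all possible measurable spaces equals f(0) + f'(∞) = ∫_0^∞ min(1,s) dν_f(s). Consequently, D_f is a finite divergence if and only if f(0) + f'(∞) < ∞. -/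
open MeasureTheory Filter Set
open scoped ENNReal NNReal Classical

noncomputable section

lemma aux_subgrad {f : ℝ → ℝ} (hf : ConvexOn ℝ (Set.Ioi 0) f) {x y : ℝ} (hx : 0 < x)
    (hy : 0 < y) : f x + rightDeriv f x * (y - x) ≤ f y := by
  have hxi : x ∈ interior (Set.Ioi (0:ℝ)) := by simpa using hx
  rcases lt_trichotomy x y with h | h | h
  · have := hf.rightDeriv_le_slope_of_mem_interior hxi hy h
    rw [slope_def_field, le_div_iff₀ (by linarith)] at this
    unfold rightDeriv
    linarith
  · subst h; simp
  · have h1 := hf.slope_le_leftDeriv_of_mem_interior hy hxi h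
    have h2 := hf.leftDeriv_le_rightDeriv_of_mem_interior hxi
    have := h1.trans h2
    rw [slope_def_field, div_le_iff₀ (by linarith)] at this
    unfold rightDeriv
    linarith

lemma aux_mono {f : ℝ → ℝ} (hf : ConvexOn ℝ (Set.Ioi 0) f) :
    MonotoneOn (rightDeriv f) (Set.Ioi 0) := by
  have := hf.monotoneOn_rightDeriv
  rwa [interior_Ioi] at this

lemma aux_cont {f : ℝ → ℝ} (hf : ConvexOn ℝ (Set.Ioi 0) f) : ContinuousOn f (Set.Ioi 0) :=
  hf.continuousOn isOpen_Ioi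

/-- The normalized function. -/
def gfun (f : ℝ → ℝ) (x : ℝ) : ℝ := f x - rightDeriv f 1 * (x - 1)

lemma gfun_nonneg {f : ℝ → ℝ} (hf : ConvexOn ℝ (Set.Ioi 0) f) (hf1 : f 1 = 0) {x : ℝ}
    (hx : 0 < x) : 0 ≤ gfun f x := by
  have := aux_subgrad hf one_pos hx
  unfold gfun
  linarith

lemma gfun_le {f : ℝ → ℝ} (hf : ConvexOn ℝ (Set.Ioi 0) f) (hf1 : f 1 = 0) {x : ℝ}
    (hx : 0 < x) : gfun f x ≤ (rightDeriv f x - rightDeriv f 1) * (x - 1) := by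
  have := aux_subgrad hf hx one_pos
  unfold gfun
  linarith

lemma le_gfun {f : ℝ → ℝ} (hf : ConvexOn ℝ (Set.Ioi 0) f) (hf1 : f 1 = 0) {x y : ℝ}
    (hx : 0 < x) (hy : 0 < y) :
    (rightDeriv f x - rightDeriv f 1) * (y - x) ≤ gfun f y := by
  have := aux_subgrad hf hx hy
  have := gfun_nonneg hf hf1 hx
  unfold gfun at *
  linarith

lemma gfun_eq {f : ℝ → ℝ} (hf : ConvexOn ℝ (Set.Ioi 0) f) (hf1 : f 1 = 0) {a : ℝ}
    (ha : 0 < a) (ha1 : a ≤ 1) :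
    ENNReal.ofReal (gfun f a)
      = ∫⁻ t in Set.Ioc a 1, ENNReal.ofReal (rightDeriv f 1 - rightDeriv f t) := by
  have hsub : Set.uIcc a 1 ⊆ Set.Ioi 0 := by
    rw [Set.uIcc_of_le ha1]
    exact fun t ht => lt_of_lt_of_le ha ht.1
  have hint : IntervalIntegrable (rightDeriv f) volume a 1 :=
    ((aux_mono hf).mono hsub).intervalIntegrable
  have h1 : ∫ t in a..1, rightDeriv f t = f 1 - f a := by
    refine intervalIntegral.integral_eq_sub_of_hasDeriv_right ((aux_cont hf).mono hsub) ?_ hint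
    intro x hx
    rw [min_eq_left ha1] at hx
    exact hf.hasDerivWithinAt_rightDeriv_of_mem_interior
      (by rw [interior_Ioi]; exact ha.trans hx.1)
  have hint2 : IntervalIntegrable (fun t => rightDeriv f 1 - rightDeriv f t) volume a 1 :=
    intervalIntegrable_const.sub hint
  have h2 : ∫ t in a..1, (rightDeriv f 1 - rightDeriv f t) = gfun f a := by
    rw [intervalIntegral.integral_sub intervalIntegrable_const hint, h1, hf1]
    simp [gfun]
    ring
  rw [← h2, intervalIntegral.integral_of_le ha1]
  rw [intervalIntegrable_iff_integrableOn_Ioc_of_le ha1] at hint2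
  refine ofReal_integral_eq_lintegral_ofReal hint2 ?_
  refine (ae_restrict_iff' measurableSet_Ioc).2 (ae_of_all _ fun t ht => ?_)
  have := aux_mono hf (ha.trans ht.1 : (0:ℝ) < t) (one_pos : (0:ℝ) < 1) ht.2
  simpa using this

lemma tendsto_A {f : ℝ → ℝ} (hf : ConvexOn ℝ (Set.Ioi 0) f) (hf1 : f 1 = 0)
    {ν : Measure ℝ} (hν : IsCurvatureMeasure f ν) :
    Tendsto (fun x => ENNReal.ofReal (gfun f x)) (nhdsWithin 0 (Set.Ioi 0))
      (nhds (∫⁻ s in Set.Ioc (0:ℝ) 1, ENNReal.ofReal s ∂ν)) := by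
  have hA : ∫⁻ s in Set.Ioc (0:ℝ) 1, ENNReal.ofReal s ∂ν
      = ∫⁻ t in Set.Ioc (0:ℝ) 1, ENNReal.ofReal (rightDeriv f 1 - rightDeriv f t) := by
    rw [lintegral_eq_lintegral_meas_lt (ν.restrict (Set.Ioc 0 1)) (f := fun s => s)
      ((ae_restrict_iff' measurableSet_Ioc).2 (ae_of_all _ fun t ht => ht.1.le))
      measurable_id.aemeasurable]
    rw [← lintegral_indicator measurableSet_Ioi, ← lintegral_indicator measurableSet_Ioc]
    congr 1
    ext t
    by_cases h0 : 0 < t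
    · rw [Set.indicator_of_mem (show t ∈ Set.Ioi 0 from h0)]
      rw [Measure.restrict_apply (show MeasurableSet {a : ℝ | t < a} from measurableSet_Ioi)]
      by_cases h1 : t ≤ 1
      · rw [Set.indicator_of_mem (show t ∈ Set.Ioc 0 1 from ⟨h0, h1⟩), ← hν t 1 h0 h1]
        congr 1
        ext s
        simp only [Set.mem_inter_iff, Set.mem_ofPred_eq, Set.mem_Ioc]
        constructor
        · rintro ⟨a, b, c⟩; exact ⟨a, c⟩
        · rintro ⟨a, b⟩; exact ⟨a, h0.trans a, b⟩
      · rw [Set.indicator_of_notMem (fun h => h1 h.2)]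
        convert measure_empty (μ := ν)
        ext s
        simp only [Set.mem_inter_iff, Set.mem_ofPred_eq, Set.mem_Ioc, Set.mem_empty_iff_false,
          iff_false]
        rintro ⟨a, b, c⟩
        exact h1 (a.le.trans c)
    · rw [Set.indicator_of_notMem (show t ∉ Set.Ioi 0 from h0), Set.indicator_of_notMem (fun h => h0 h.1)]
  rw [hA]
  have hcov : AECover (volume.restrict (Set.Ioc (0:ℝ) 1)) (nhdsWithin 0 (Set.Ioi 0))
      (fun a : ℝ => Set.Ioc a 1) :=
    aecover_Ioc_of_Ioc (tendsto_id.mono_left nhdsWithin_le_nhds) tendsto_const_nhds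
  have hmeas : AEMeasurable (fun t => ENNReal.ofReal (rightDeriv f 1 - rightDeriv f t))
      (volume.restrict (Set.Ioc (0:ℝ) 1)) := by
    refine ENNReal.measurable_ofReal.comp_aemeasurable ?_
    refine aemeasurable_const.sub ?_
    exact aemeasurable_restrict_of_monotoneOn measurableSet_Ioc
      ((aux_mono hf).mono fun t ht => ht.1)
  have := hcov.lintegral_tendsto_of_countably_generated hmeas
  refine this.congr' ?_
  filter_upwards [Ioc_mem_nhdsGT (zero_lt_one' ℝ)] with a ha
  rw [gfun_eq hf hf1 ha.1 ha.2, Measure.restrict_restrict measurableSet_Ioc]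
  congr 2
  exact Set.inter_eq_left.2 (Set.Ioc_subset_Ioc_left ha.1.le)

lemma tendsto_r {f : ℝ → ℝ} {ν : Measure ℝ} (hν : IsCurvatureMeasure f ν) :
    Tendsto (fun x => ENNReal.ofReal (rightDeriv f x - rightDeriv f 1)) atTop
      (nhds (ν (Set.Ioi 1))) := by
  have h : Tendsto (fun x : ℝ => ν (Set.Ioc 1 x)) atTop (nhds (ν (⋃ x : ℝ, Set.Ioc 1 x))) :=
    tendsto_measure_iUnion_atTop (fun a b hab => Set.Ioc_subset_Ioc_right hab)
  rw [Set.iUnion_Ioc_right] at h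
  refine h.congr' ?_
  filter_upwards [eventually_ge_atTop 1] with x hx
  exact hν 1 x one_pos hx

lemma tendsto_B {f : ℝ → ℝ} (hf : ConvexOn ℝ (Set.Ioi 0) f) (hf1 : f 1 = 0)
    {ν : Measure ℝ} (hν : IsCurvatureMeasure f ν) :
    Tendsto (fun x => ENNReal.ofReal (gfun f x / x)) atTop (nhds (ν (Set.Ioi 1))) := by
  have hr := tendsto_r hν
  have hlow : Tendsto (fun x => ENNReal.ofReal (rightDeriv f (√x) - rightDeriv f 1)
      * ENNReal.ofReal (1 - 1 / √x)) atTop (nhds (ν (Set.Ioi 1) * 1)) := by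
    refine ENNReal.Tendsto.mul (hr.comp Real.tendsto_sqrt_atTop) (Or.inr (by simp)) ?_
      (Or.inl one_ne_zero)
    have : Tendsto (fun x => 1 - 1 / √x) atTop (nhds (1 - 0)) := by
      refine tendsto_const_nhds.sub ?_
      simp only [one_div]
      exact tendsto_inv_atTop_zero.comp Real.tendsto_sqrt_atTop
    simpa using ENNReal.tendsto_ofReal this
  rw [mul_one] at hlow
  refine tendsto_of_tendsto_of_tendsto_of_le_of_le' hlow hr ?_ ?_
  · filter_upwards [eventually_ge_atTop 1] with x hx
    have hs1 : 1 ≤ √x := by simpa using hx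
    have hx0 : 0 < x := by linarith
    have hm := aux_mono hf (one_pos : (0:ℝ) < 1) (by linarith : (0:ℝ) < √x) hs1
    rw [← ENNReal.ofReal_mul (by linarith)]
    refine ENNReal.ofReal_le_ofReal ?_
    rw [le_div_iff₀ hx0]
    have := le_gfun hf hf1 (by linarith : (0:ℝ) < √x) hx0
    refine le_trans (le_of_eq ?_) this
    have hsq : √x * √x = x := Real.mul_self_sqrt hx0.le
    have : (1 - 1 / √x) * x = x - √x := by
      rw [sub_mul, one_mul, ← Real.sqrt_div_self']
      field_simp
    rw [mul_assoc, this]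
  · filter_upwards [eventually_ge_atTop 1] with x hx
    have hx0 : 0 < x := by linarith
    refine ENNReal.ofReal_le_ofReal ?_
    rw [div_le_iff₀ hx0]
    have hm := aux_mono hf (one_pos : (0:ℝ) < 1) hx0 hx
    have := gfun_le hf hf1 hx0
    nlinarith

lemma limAtZero_eq {f : ℝ → ℝ} (hf : ConvexOn ℝ (Set.Ioi 0) f) (hf1 : f 1 = 0)
    {ν : Measure ℝ} (hν : IsCurvatureMeasure f ν) :
    limAtZero f = ((∫⁻ s in Set.Ioc (0:ℝ) 1, ENNReal.ofReal s ∂ν : ℝ≥0∞) : EReal)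
      + ((- rightDeriv f 1 : ℝ) : EReal) := by
  refine Tendsto.limsup_eq ?_
  have h1 := (continuous_coe_ennreal_ereal.tendsto _).comp (tendsto_A hf hf1 hν)
  have h2 : Tendsto (fun x : ℝ => ((rightDeriv f 1 * (x - 1) : ℝ) : EReal))
      (nhdsWithin 0 (Set.Ioi 0)) (nhds ((- rightDeriv f 1 : ℝ) : EReal)) := by
    refine (continuous_coe_real_ereal.tendsto _).comp ?_
    have : Continuous (fun x : ℝ => rightDeriv f 1 * (x - 1)) := by fun_prop
    have := this.tendsto 0
    simp only [zero_sub, mul_neg, mul_one] at this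
    exact this.mono_left nhdsWithin_le_nhds
  have h3 := (EReal.continuousAt_add (p := (_, _)) (Or.inr (EReal.coe_ne_bot _))
    (Or.inr (EReal.coe_ne_top _))).tendsto.comp (h1.prodMk_nhds h2)
  refine h3.congr' ?_
  filter_upwards [self_mem_nhdsWithin] with x hx
  simp only [Function.comp]
  rw [EReal.coe_ennreal_ofReal, max_eq_left (gfun_nonneg hf hf1 hx), ← EReal.coe_add]
  congr 1
  unfold gfun
  ring

lemma derivAtTop_eq {f : ℝ → ℝ} (hf : ConvexOn ℝ (Set.Ioi 0) f) (hf1 : f 1 = 0)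
    {ν : Measure ℝ} (hν : IsCurvatureMeasure f ν) :
    derivAtTop f = ((ν (Set.Ioi 1) : ℝ≥0∞) : EReal) + ((rightDeriv f 1 : ℝ) : EReal) := by
  refine Tendsto.limsup_eq ?_
  have h1 := (continuous_coe_ennreal_ereal.tendsto _).comp (tendsto_B hf hf1 hν)
  have h2 : Tendsto (fun x : ℝ => ((rightDeriv f 1 * (1 - x⁻¹) : ℝ) : EReal))
      atTop (nhds ((rightDeriv f 1 : ℝ) : EReal)) := by
    refine (continuous_coe_real_ereal.tendsto _).comp ?_
    have : Tendsto (fun x : ℝ => rightDeriv f 1 * (1 - x⁻¹)) atTop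
      (nhds (rightDeriv f 1 * (1 - 0))) :=
      (tendsto_const_nhds.sub tendsto_inv_atTop_zero).const_mul _
    simpa using this
  have h3 := (EReal.continuousAt_add (p := (_, _)) (Or.inr (EReal.coe_ne_bot _))
    (Or.inr (EReal.coe_ne_top _))).tendsto.comp (h1.prodMk_nhds h2)
  refine h3.congr' ?_
  filter_upwards [eventually_gt_atTop 0] with x hx
  simp only [Function.comp]
  rw [EReal.coe_ennreal_ofReal, max_eq_left (div_nonneg (gfun_nonneg hf hf1 hx) hx.le),
    ← EReal.coe_add]
  congr 1
  unfold gfun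
  field_simp
  ring

lemma gfun_bound {f : ℝ → ℝ} (hf : ConvexOn ℝ (Set.Ioi 0) f) (hf1 : f 1 = 0)
    {ν : Measure ℝ} (hν : IsCurvatureMeasure f ν) {A B : ℝ} (hA : 0 ≤ A) (hB : 0 ≤ B)
    (hA' : ∫⁻ s in Set.Ioc (0:ℝ) 1, ENNReal.ofReal s ∂ν = ENNReal.ofReal A)
    (hB' : ν (Set.Ioi 1) = ENNReal.ofReal B) {x : ℝ} (hx : 0 < x) :
    gfun f x ≤ A + B * x := by
  rcases le_total x 1 with h | h
  · have : ENNReal.ofReal (gfun f x) ≤ ENNReal.ofReal A := by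
      rw [← hA']
      refine ge_of_tendsto (tendsto_A hf hf1 hν) ?_
      filter_upwards [Ioc_mem_nhdsGT hx] with a ha
      rw [gfun_eq hf hf1 hx h, gfun_eq hf hf1 ha.1 (ha.2.trans h)]
      exact lintegral_mono_set (Set.Ioc_subset_Ioc_left ha.2)
    have := (ENNReal.ofReal_le_ofReal_iff hA).1 this
    nlinarith
  · have : ENNReal.ofReal (rightDeriv f x - rightDeriv f 1) ≤ ENNReal.ofReal B := by
      rw [← hB', ← hν 1 x one_pos h]
      exact measure_mono Set.Ioc_subset_Ioi_self
    have := (ENNReal.ofReal_le_ofReal_iff hB).1 this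
    have := gfun_le hf hf1 hx
    nlinarith

lemma lintegral_split (ν : Measure ℝ) :
    ∫⁻ s in Set.Ioi (0 : ℝ), ENNReal.ofReal (min 1 s) ∂ν
      = ∫⁻ s in Set.Ioc (0:ℝ) 1, ENNReal.ofReal s ∂ν + ν (Set.Ioi 1) := by
  rw [← Set.Ioc_union_Ioi_eq_Ioi (zero_le_one' ℝ),
    lintegral_union measurableSet_Ioi (Set.Ioc_disjoint_Ioi le_rfl)]
  congr 1
  · refine setLIntegral_congr_fun measurableSet_Ioc fun s hs => ?_
    simp only [min_eq_right hs.2]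
  · rw [setLIntegral_congr_fun (g := fun _ => 1) measurableSet_Ioi fun s hs => ?_]
    · simp
    · simp only [min_eq_left (le_of_lt (show (1:ℝ) < s from hs)), ENNReal.ofReal_one]

lemma fDiv_le {f : ℝ → ℝ} (hf : ConvexOn ℝ (Set.Ioi 0) f)
    {a b c : ℝ} (hlow : ∀ x, 0 < x → c * (x - 1) ≤ f x) (hup : ∀ x, 0 < x → f x ≤ a + b * x)
    (hL : limAtZero f = (a : EReal)) (hD : derivAtTop f = (b : EReal))
    {Ω : Type*} [MeasurableSpace Ω] (P Q : Measure Ω) [IsProbabilityMeasure P]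
    [IsProbabilityMeasure Q] : fDiv f P Q ≤ ((a + b : ℝ) : EReal) := by
  set p : Ω → ℝ := fun x => (P.rnDeriv Q x).toReal with hp
  have hpm : Measurable p := (Measure.measurable_rnDeriv P Q).ennreal_toReal
  set S : Set Ω := {x | P.rnDeriv Q x ≠ 0} with hS
  have hSm : MeasurableSet S :=
    (Measure.measurable_rnDeriv P Q (measurableSet_singleton 0)).compl
  have hpos : ∀ᵐ x ∂(Q.restrict S), 0 < p x := by
    rw [ae_restrict_iff' hSm]
    filter_upwards [Measure.rnDeriv_lt_top P Q] with x hx hxS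
    exact ENNReal.toReal_pos hxS hx.ne
  have hpi : Integrable p Q := Measure.integrable_toReal_rnDeriv
  have hpiS : Integrable p (Q.restrict S) := hpi.restrict
  have hmeas : AEStronglyMeasurable (fun x => f (p x)) (Q.restrict S) := by
    have hm : Measurable ((Set.Ioi (0:ℝ)).piecewise f (fun _ => 0)) :=
      (aux_cont hf).measurable_piecewise continuousOn_const measurableSet_Ioi
    refine (hm.comp hpm).aestronglyMeasurable.congr ?_
    filter_upwards [hpos] with x hx
    simp [Set.piecewise, hx]
  have hup_i : Integrable (fun x => a + b * p x) (Q.restrict S) :=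
    (integrable_const a).add (hpiS.const_mul b)
  have hlow_i : Integrable (fun x => c * (p x - 1)) (Q.restrict S) :=
    (hpiS.sub (integrable_const 1)).const_mul c
  have hint : Integrable (fun x => f (p x)) (Q.restrict S) := by
    refine integrable_of_le_of_le hmeas ?_ ?_ hlow_i hup_i
    · filter_upwards [hpos] with x hx using hlow _ hx
    · filter_upwards [hpos] with x hx using hup _ hx
  have hle : ∫ x in S, f (p x) ∂Q ≤ ∫ x in S, (a + b * p x) ∂Q := by
    refine integral_mono_ae hint hup_i ?_
    filter_upwards [hpos] with x hx using hup _ hx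
  have hSp : ∫ x in S, p x ∂Q = ∫ x, p x ∂Q := by
    refine setIntegral_eq_integral_of_forall_compl_eq_zero fun x hx => ?_
    have : P.rnDeriv Q x = 0 := by simpa [hS] using hx
    simp [hp, this]
  have hpI : ∫ x, p x ∂Q = 1 - (P.singularPart Q).real Set.univ := by
    rw [hp, Measure.integral_toReal_rnDeriv']
    simp
  have hval : ∫ x in S, (a + b * p x) ∂Q
      = a * Q.real S + b * (1 - (P.singularPart Q).real Set.univ) := by
    rw [integral_add (integrable_const a) (hpiS.const_mul b), integral_const_mul, hSp, hpI]
    simp [mul_comm]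
  have hSc : {x | P.rnDeriv Q x = 0} = Sᶜ := by
    ext x; simp [hS]
  have hQ : Q.real Sᶜ = 1 - Q.real S := by
    rw [measureReal_compl hSm]; simp
  unfold fDiv
  rw [if_pos hint, hL, hD, hSc, ← ENNReal.ofReal_toReal (measure_ne_top Q Sᶜ),
    ← ENNReal.ofReal_toReal (measure_ne_top (P.singularPart Q) Set.univ),
    EReal.coe_ennreal_ofReal, EReal.coe_ennreal_ofReal, max_eq_left ENNReal.toReal_nonneg,
    max_eq_left ENNReal.toReal_nonneg, ← EReal.coe_mul, ← EReal.coe_mul, ← EReal.coe_add,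
    ← EReal.coe_add, EReal.coe_le_coe_iff]
  change ∫ x in S, f (p x) ∂Q + a * Q.real Sᶜ + b * (P.singularPart Q).real Set.univ ≤ a + b
  rw [hQ]
  nlinarith

lemma fDiv_dirac (f : ℝ → ℝ) :
    fDiv f (Measure.dirac true) (Measure.dirac false) = limAtZero f + derivAtTop f := by
  have hms : (Measure.dirac true : Measure Bool) ⟂ₘ Measure.dirac false := by
    refine ⟨{false}, measurableSet_singleton _, ?_, ?_⟩ <;> simp
  have h0 := hms.rnDeriv_ae_eq_zero
  have hS : (Measure.dirac false : Measure Bool)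
      {x | Measure.rnDeriv (Measure.dirac true) (Measure.dirac false) x ≠ 0} = 0 := h0
  have hS' : (Measure.dirac false : Measure Bool)
      {x | Measure.rnDeriv (Measure.dirac true) (Measure.dirac false) x = 0} = 1 :=
    prob_compl_eq_zero_iff (MeasurableSet.of_discrete) |>.1 hS
  unfold fDiv
  rw [Measure.restrict_eq_zero.2 hS, (Measure.singularPart_eq_self).2 hms, hS']
  simp

/-- **Remark 2 (finiteness of a divergence).** The supremum of `D_f(P‖Q)` over all pairs of
probability measures on all measurable spaces equals `f(0) + f'(∞)`, which also equals
`∫_{(0,∞)} min(1,s) dν_f(s)`; consequently `D_f` is a finite divergence iff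
`f(0) + f'(∞) < ∞`. -/
theorem sup_fDiv_eq_limAtZero_add_derivAtTop (f : ℝ → ℝ)
    (hf : ConvexOn ℝ (Set.Ioi 0) f) (hf1 : f 1 = 0)
    (ν : Measure ℝ) (hν : IsCurvatureMeasure f ν) :
    sSup {x : EReal | ∃ pp : PMPair, x = fDiv f pp.P pp.Q}
      = limAtZero f + derivAtTop f ∧
    ((∫⁻ s in Set.Ioi (0 : ℝ), ENNReal.ofReal (min 1 s) ∂ν : ℝ≥0∞) : EReal)
      = limAtZero f + derivAtTop f ∧
    (sSup {x : EReal | ∃ pp : PMPair, x = fDiv f pp.P pp.Q} < ⊤ ↔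
      limAtZero f + derivAtTop f < (⊤ : EReal)) := by
  set A : ℝ≥0∞ := ∫⁻ s in Set.Ioc (0:ℝ) 1, ENNReal.ofReal s ∂ν with hAdef
  set B : ℝ≥0∞ := ν (Set.Ioi 1) with hBdef
  set c : ℝ := rightDeriv f 1 with hc
  have hL : limAtZero f = (A : EReal) + ((-c : ℝ) : EReal) := limAtZero_eq hf hf1 hν
  have hD : derivAtTop f = (B : EReal) + (c : EReal) := derivAtTop_eq hf hf1 hν
  have hsum : limAtZero f + derivAtTop f = ((A + B : ℝ≥0∞) : EReal) := by
    rw [hL, hD, add_add_add_comm, ← EReal.coe_add, EReal.coe_ennreal_add]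
    simp
  have hsup : sSup {x : EReal | ∃ pp : PMPair, x = fDiv f pp.P pp.Q}
      = limAtZero f + derivAtTop f := by
    refine le_antisymm (sSup_le ?_) (le_sSup ?_)
    · rintro _ ⟨pp, rfl⟩
      have := pp.probP
      have := pp.probQ
      by_cases htop : A + B = ⊤
      · rw [hsum, htop]
        simp
      · rw [ENNReal.add_eq_top, not_or] at htop
        have hA' : A = ENNReal.ofReal A.toReal := (ENNReal.ofReal_toReal htop.1).symm
        have hB' : B = ENNReal.ofReal B.toReal := (ENNReal.ofReal_toReal htop.2).symm
        have hL' : limAtZero f = ((A.toReal - c : ℝ) : EReal) := by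
          rw [hL, hA', EReal.coe_ennreal_ofReal, max_eq_left ENNReal.toReal_nonneg,
            ← EReal.coe_add, ← hA', sub_eq_add_neg]
        have hD' : derivAtTop f = ((B.toReal + c : ℝ) : EReal) := by
          rw [hD, hB', EReal.coe_ennreal_ofReal, max_eq_left ENNReal.toReal_nonneg,
            ← EReal.coe_add, ← hB']
        have := fDiv_le hf (a := A.toReal - c) (b := B.toReal + c) (c := c)
          (fun x hx => by
            have := gfun_nonneg hf hf1 hx
            unfold gfun at this
            linarith)
          (fun x hx => by
            have := gfun_bound hf hf1 hν ENNReal.toReal_nonneg ENNReal.toReal_nonneg hA' hB' hx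
            unfold gfun at this
            linarith) hL' hD' pp.P pp.Q
        rw [hL', hD', ← EReal.coe_add]
        exact this
    · exact ⟨⟨Bool, inferInstance, Measure.dirac true, Measure.dirac false, inferInstance,
        inferInstance⟩, (fDiv_dirac f).symm⟩
  refine ⟨hsup, ?_, by rw [hsup]⟩
  rw [hsum, lintegral_split]

end
end
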